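/- arXiv:2504.12603 — 4 statements merged into one kernel-verified Lean document; each statement's English description precedes it below -/
import Mathlib

section
/- Assume cov(ℳ) = 𝔠. Then there exists a Mazurkiewicz set M ⊆ ℝ × ℝ such that for every θ ∈ ℝ, the rotated set ρ_θ(M) is both a Mazurkiewicz set and a Sierpiński–Zygmund set. -/
open Cardinal Set

noncomputable section

/-- The line through `p` with direction `v`. -/
def lineThrough (p v : ℝ × ℝ) : Set (ℝ × ℝ) := {q | ∃ t : ℝ, q = p + t • v}

/-- `L` is a straight line of `ℝ²`. -/
def IsLine (L : Set (ℝ × ℝ)) : Prop := ∃ p v : ℝ × ℝ, v ≠ 0 ∧ L = lineThrough p v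

/-- `L` is a vertical line of `ℝ²`. -/
def IsVerticalLine (L : Set (ℝ × ℝ)) : Prop := ∃ x : ℝ, L = {p : ℝ × ℝ | p.1 = x}

/-- `L₁` and `L₂` are parallel lines. -/
def ParallelLines (L₁ L₂ : Set (ℝ × ℝ)) : Prop :=
  ∃ (p₁ p₂ v : ℝ × ℝ) (c : ℝ), v ≠ 0 ∧ c ≠ 0 ∧
    L₁ = lineThrough p₁ v ∧ L₂ = lineThrough p₂ (c • v)

/-- A Mazurkiewicz set meets every line in exactly two points. -/
def IsMazurkiewicz (M : Set (ℝ × ℝ)) : Prop :=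
  ∀ L : Set (ℝ × ℝ), IsLine L → (M ∩ L).encard = 2

/-- The graph of a partial function `g` defined on `S ⊆ ℝ`. -/
def graphOn (S : Set ℝ) (g : S → ℝ) : Set (ℝ × ℝ) := {p | ∃ x : S, p = ((x : ℝ), g x)}

/-- The graph of a function `f : ℝ → ℝ`. -/
def graphOf (f : ℝ → ℝ) : Set (ℝ × ℝ) := {p | ∃ x : ℝ, p = (x, f x)}

/-- A Sierpiński–Zygmund set. -/
def IsSZSet (X : Set (ℝ × ℝ)) : Prop :=
  ∀ (S : Set ℝ) (g : S → ℝ), Continuous g →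
    #↥(X ∩ graphOn S g) < Cardinal.continuum

/-- A Sierpiński–Zygmund function. -/
def IsSZFun (f : ℝ → ℝ) : Prop :=
  ∀ (S : Set ℝ) (g : S → ℝ), Continuous g →
    #↥{x : S | f x.1 = g x} < Cardinal.continuum

/-- Rotation about the origin by angle `θ`. -/
def rot (θ : ℝ) (p : ℝ × ℝ) : ℝ × ℝ :=
  (p.1 * Real.cos θ - p.2 * Real.sin θ, p.1 * Real.sin θ + p.2 * Real.cos θ)

/-- A Hamel basis of `ℝ²`: a basis of `ℝ × ℝ` as a vector space over `ℚ`. -/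
def IsHamelBasis (H : Set (ℝ × ℝ)) : Prop :=
  LinearIndependent ℚ ((↑) : H → ℝ × ℝ) ∧ Submodule.span ℚ H = ⊤

/-- A Hamel function: a function whose graph is a Hamel basis of `ℝ²`. -/
def IsHamelFun (h : ℝ → ℝ) : Prop := IsHamelBasis (graphOf h)

/-- `cov(ℳ) = 𝔠`: no union of fewer than `𝔠`-many meager subsets of `ℝ` covers `ℝ`. -/
def CovMeagerEqContinuum : Prop :=
  ∀ (I : Type) (A : I → Set ℝ), #I < Cardinal.continuum →
    (∀ i : I, IsMeagre (A i)) → (⋃ i : I, A i) ≠ Set.univ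

/-! ### Lines -/

/-- `X` meets every line in at most two points. -/
def IsPartialTwoPointSet (X : Set (ℝ × ℝ)) : Prop :=
  ∀ L : Set (ℝ × ℝ), IsLine L → (X ∩ L).encard ≤ 2

lemma isLine_lineThrough (p : ℝ × ℝ) {v : ℝ × ℝ} (hv : v ≠ 0) : IsLine (lineThrough p v) :=
  ⟨p, v, hv, rfl⟩

lemma IsLine.eq_lineThrough {L : Set (ℝ × ℝ)} (hL : IsLine L) {x y : ℝ × ℝ} (hx : x ∈ L)
    (hy : y ∈ L) (hxy : x ≠ y) : L = lineThrough x (y - x) := by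
  obtain ⟨p, v, hv, rfl⟩ := hL
  obtain ⟨a, rfl⟩ := hx
  obtain ⟨b, rfl⟩ := hy
  have hab : b - a ≠ 0 := fun h => hxy (by rw [sub_eq_zero.1 h])
  ext q
  constructor
  · rintro ⟨t, rfl⟩
    refine ⟨(t - a) / (b - a), ?_⟩
    have h : t = a + (t - a) / (b - a) * (b - a) := by field_simp; ring
    nth_rewrite 1 [h]
    module
  · rintro ⟨s, rfl⟩
    exact ⟨a + s * (b - a), by module⟩

lemma IsLine.eq_of_mem {L L' : Set (ℝ × ℝ)} (hL : IsLine L) (hL' : IsLine L') {x y : ℝ × ℝ}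
    (hx : x ∈ L) (hy : y ∈ L) (hx' : x ∈ L') (hy' : y ∈ L') (hxy : x ≠ y) : L = L' :=
  (hL.eq_lineThrough hx hy hxy).trans (hL'.eq_lineThrough hx' hy' hxy).symm

lemma lineThrough_injective (p : ℝ × ℝ) {v : ℝ × ℝ} (hv : v ≠ 0) :
    Function.Injective fun t : ℝ => p + t • v :=
  (add_right_injective p).comp (smul_left_injective ℝ hv)

lemma IsLine.isClosed {L : Set (ℝ × ℝ)} (hL : IsLine L) : IsClosed L := by
  obtain ⟨p, v, hv, rfl⟩ := hL
  have h : lineThrough p v = {q : ℝ × ℝ | (q.1 - p.1) * v.2 = (q.2 - p.2) * v.1} := by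
    ext q
    constructor
    · rintro ⟨t, rfl⟩
      simp only [mem_ofPred_eq, Prod.fst_add, Prod.snd_add, Prod.smul_fst, Prod.smul_snd,
        smul_eq_mul]
      ring
    · intro (hq : (q.1 - p.1) * v.2 = (q.2 - p.2) * v.1)
      by_cases h1 : v.1 = 0
      · have h2 : v.2 ≠ 0 := fun h2 => hv (Prod.ext h1 h2)
        have h3 : q.1 - p.1 = 0 := by simpa [h1, h2] using hq
        refine ⟨(q.2 - p.2) / v.2, Prod.ext ?_ ?_⟩ <;> simp [h1, h2]
        linarith
      · refine ⟨(q.1 - p.1) / v.1, Prod.ext ?_ ?_⟩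
        · simp [h1]
        · have h4 : (q.1 - p.1) / v.1 * v.2 = q.2 - p.2 := by field_simp; linarith
          simp [h4]
  rw [h]
  exact isClosed_eq (by fun_prop) (by fun_prop)

/-! ### Rotations -/

lemma rot_add_smul (θ : ℝ) (p v : ℝ × ℝ) (t : ℝ) :
    rot θ (p + t • v) = rot θ p + t • rot θ v := by
  ext <;> simp [rot] <;> ring

lemma rot_neg_rot (θ : ℝ) (p : ℝ × ℝ) : rot (-θ) (rot θ p) = p := by
  have h := Real.sin_sq_add_cos_sq θ
  ext <;> simp only [rot, Real.cos_neg, Real.sin_neg]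
  · linear_combination p.1 * h
  · linear_combination p.2 * h

lemma rot_rot_neg (θ : ℝ) (p : ℝ × ℝ) : rot θ (rot (-θ) p) = p := by
  simpa using rot_neg_rot (-θ) p

lemma rot_injective (θ : ℝ) : Function.Injective (rot θ) :=
  Function.LeftInverse.injective (rot_neg_rot θ)

lemma rot_ne_zero (θ : ℝ) {v : ℝ × ℝ} (hv : v ≠ 0) : rot θ v ≠ 0 := by
  intro h
  apply hv
  apply rot_injective θ
  rw [h]
  ext <;> simp [rot]

lemma rot_image_lineThrough (θ : ℝ) (p v : ℝ × ℝ) :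
    rot θ '' lineThrough p v = lineThrough (rot θ p) (rot θ v) := by
  ext q
  constructor
  · rintro ⟨_, ⟨t, rfl⟩, rfl⟩
    exact ⟨t, rot_add_smul θ p v t⟩
  · rintro ⟨t, rfl⟩
    exact ⟨_, ⟨t, rfl⟩, rot_add_smul θ p v t⟩

lemma IsLine.rot {L : Set (ℝ × ℝ)} (hL : IsLine L) (θ : ℝ) : IsLine (rot θ '' L) := by
  obtain ⟨p, v, hv, rfl⟩ := hL
  exact ⟨_, _, rot_ne_zero θ hv, rot_image_lineThrough θ p v⟩

lemma IsMazurkiewicz.rot {M : Set (ℝ × ℝ)} (hM : IsMazurkiewicz M) (θ : ℝ) :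
    IsMazurkiewicz (rot θ '' M) := by
  intro L hL
  have h : L = _root_.rot θ '' (_root_.rot (-θ) '' L) := by
    simp [image_image, rot_rot_neg]
  rw [h, ← image_inter (rot_injective θ), (rot_injective θ).encard_image]
  exact hM _ (hL.rot _)

/-! ### Continuous partial functions coded by sequences -/

/-- The points `(x, y)` such that `x` is adherent to the first coordinates of `u`, and the second
coordinates of `u` tend to `y` as the first ones tend to `x`. -/
def limitGraph (u : ℕ → ℝ × ℝ) : Set (ℝ × ℝ) :=
  {p | (∀ δ > 0, ∃ n, |(u n).1 - p.1| < δ) ∧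
    ∀ ε > 0, ∃ δ > 0, ∀ n, |(u n).1 - p.1| < δ → |(u n).2 - p.2| < ε}

lemma limitGraph_continuous {u : ℕ → ℝ × ℝ} {p : ℝ × ℝ} (hp : p ∈ limitGraph u) {ε : ℝ}
    (hε : 0 < ε) : ∃ δ > 0, ∀ q ∈ limitGraph u, |q.1 - p.1| < δ → |q.2 - p.2| < ε := by
  obtain ⟨δ, hδ, h⟩ := hp.2 (ε / 2) (half_pos hε)
  refine ⟨δ, hδ, fun q hq hqp => ?_⟩
  obtain ⟨δ', hδ', h'⟩ := hq.2 (ε / 2) (half_pos hε)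
  obtain ⟨n, hn⟩ := hq.1 (min δ' (δ - |q.1 - p.1|)) (lt_min hδ' (sub_pos.2 hqp))
  have h1 := h' n (hn.trans_le (min_le_left _ _))
  have h2 : |(u n).1 - p.1| < δ := by
    have := abs_sub_le (u n).1 q.1 p.1
    have := hn.trans_le (min_le_right _ _)
    linarith
  have h3 := abs_sub_le q.2 (u n).2 p.2
  rw [abs_sub_comm q.2 (u n).2] at h3
  linarith [h n h2]

lemma limitGraph_eq_of_fst_eq {u : ℕ → ℝ × ℝ} {p q : ℝ × ℝ} (hp : p ∈ limitGraph u)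
    (hq : q ∈ limitGraph u) (h : q.1 = p.1) : q = p := by
  refine Prod.ext h (eq_of_abs_sub_nonpos ?_)
  refine le_of_forall_pos_le_add fun ε hε => ?_
  obtain ⟨δ, hδ, H⟩ := limitGraph_continuous hp hε
  simpa using (H q hq (by simpa [h] using hδ)).le

lemma exists_graphOn_subset_limitGraph (S : Set ℝ) (g : S → ℝ) (hg : Continuous g) :
    ∃ u : ℕ → ℝ × ℝ, graphOn S g ⊆ limitGraph u := by
  rcases isEmpty_or_nonempty S with hS | hS
  · exact ⟨fun _ => 0, by rintro _ ⟨x, -⟩; exact hS.elim x⟩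
  refine ⟨fun n => (TopologicalSpace.denseSeq S n, g (TopologicalSpace.denseSeq S n)), ?_⟩
  rintro _ ⟨x, rfl⟩
  refine ⟨fun δ hδ => ?_, fun ε hε => ?_⟩
  · obtain ⟨n, hn⟩ := (TopologicalSpace.denseRange_denseSeq S).exists_dist_lt x hδ
    exact ⟨n, by rwa [dist_comm] at hn⟩
  · obtain ⟨δ, hδ, h⟩ := Metric.continuous_iff.1 hg x ε hε
    exact ⟨δ, hδ, fun n hn => h _ hn⟩

lemma Set.Subsingleton.isMeagre_real {s : Set ℝ} (hs : s.Subsingleton) : IsMeagre s := by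
  apply IsNowhereDense.isMeagre
  rcases hs.eq_empty_or_singleton with rfl | ⟨x, rfl⟩ <;> simp [IsNowhereDense]

/-- Some parametrization of the line `L` meets `G` in a nonmeagre set of parameters. -/
def MeetsNonmeagrely (L G : Set (ℝ × ℝ)) : Prop :=
  ∃ p v : ℝ × ℝ, v ≠ 0 ∧ L = lineThrough p v ∧ ¬IsMeagre {t : ℝ | p + t • v ∈ G}

/-- The first coordinates of the points of `A` are dense in the interval `(a, b)`. -/
def FstDenseIn (A : Set (ℝ × ℝ)) (a b : ℝ) : Prop :=
  ∀ x, a < x → x < b → ∀ δ > 0, ∃ q ∈ A, |q.1 - x| < δ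

lemma MeetsNonmeagrely.exists_fstDenseIn {L : Set (ℝ × ℝ)} {u : ℕ → ℝ × ℝ}
    (h : MeetsNonmeagrely L (limitGraph u)) :
    ∃ a b : ℚ, (a : ℝ) < b ∧ FstDenseIn (L ∩ limitGraph u) a b := by
  obtain ⟨p, v, hv, rfl, h⟩ := h
  have hv1 : v.1 ≠ 0 := by
    intro hv1
    refine h (Set.Subsingleton.isMeagre_real fun s hs t ht => ?_)
    exact lineThrough_injective p hv (limitGraph_eq_of_fst_eq ht hs (by simp [hv1]))
  have hvpos := abs_pos.2 hv1
  obtain ⟨t₀, ht₀⟩ : (interior (closure {t : ℝ | p + t • v ∈ limitGraph u})).Nonempty :=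
    nonempty_iff_ne_empty.2 fun h' => h (IsNowhereDense.isMeagre h')
  obtain ⟨r, hr, hball⟩ := Metric.isOpen_iff.1 isOpen_interior t₀ ht₀
  have hrv : 0 < r * |v.1| := mul_pos hr hvpos
  obtain ⟨a, ha, ha'⟩ := exists_rat_btwn
    (show p.1 + t₀ * v.1 - r * |v.1| < p.1 + t₀ * v.1 by linarith)
  obtain ⟨b, hb, hb'⟩ := exists_rat_btwn
    (show p.1 + t₀ * v.1 < p.1 + t₀ * v.1 + r * |v.1| by linarith)
  refine ⟨a, b, ha'.trans hb, fun x hax hxb δ hδ => ?_⟩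
  have hx : p.1 + (x - p.1) / v.1 * v.1 = x := by field_simp; ring
  have hmem : (x - p.1) / v.1 ∈ closure {t : ℝ | p + t • v ∈ limitGraph u} := by
    apply interior_subset
    apply hball
    rw [Metric.mem_ball, Real.dist_eq, ← mul_lt_mul_iff_left₀ hvpos, ← abs_mul, abs_lt]
    constructor <;> linarith
  obtain ⟨t, ht, htx⟩ := Metric.mem_closure_iff.1 hmem (δ / |v.1|) (div_pos hδ hvpos)
  refine ⟨p + t • v, ⟨⟨t, rfl⟩, ht⟩, ?_⟩
  rw [dist_comm, Real.dist_eq, lt_div_iff₀ hvpos, ← abs_mul] at htx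
  have : (p + t • v).1 - x = (t - (x - p.1) / v.1) * v.1 := by
    simp only [Prod.fst_add, Prod.smul_fst, smul_eq_mul]
    linarith
  rwa [this]

lemma FstDenseIn.mem_of_mem_limitGraph {L : Set (ℝ × ℝ)} (hL : IsClosed L) {u : ℕ → ℝ × ℝ}
    {a b : ℝ} (h : FstDenseIn (L ∩ limitGraph u) a b) {q : ℝ × ℝ} (hq : q ∈ limitGraph u)
    (ha : a < q.1) (hb : q.1 < b) : q ∈ L := by
  rw [← hL.closure_eq, Metric.mem_closure_iff]
  intro ε hε
  obtain ⟨δ, hδ, H⟩ := limitGraph_continuous hq hε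
  obtain ⟨r, ⟨hrL, hru⟩, hr⟩ := h q.1 ha hb (min δ ε) (lt_min hδ hε)
  refine ⟨r, hrL, ?_⟩
  rw [dist_comm, Prod.dist_eq]
  exact max_lt (hr.trans_le (min_le_right _ _)) (H r hru (hr.trans_le (min_le_left _ _)))

lemma eq_of_fstDenseIn {L L' : Set (ℝ × ℝ)} (hL : IsLine L) (hL' : IsLine L') {u : ℕ → ℝ × ℝ}
    {a b : ℝ} (hab : a < b) (h : FstDenseIn (L ∩ limitGraph u) a b)
    (h' : FstDenseIn (L' ∩ limitGraph u) a b) : L = L' := by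
  obtain ⟨c, hac, hcb⟩ := exists_between hab
  obtain ⟨q, ⟨hqL, hqu⟩, hq⟩ := h ((a + c) / 2) (by linarith) (by linarith)
    ((c - a) / 2) (by linarith)
  obtain ⟨r, ⟨hrL, hru⟩, hr⟩ := h ((c + b) / 2) (by linarith) (by linarith)
    ((b - c) / 2) (by linarith)
  rw [abs_lt] at hq hr
  refine hL.eq_of_mem hL' hqL hrL ?_ ?_ fun hqr => ?_
  · exact h'.mem_of_mem_limitGraph hL'.isClosed hqu (by linarith) (by linarith)
  · exact h'.mem_of_mem_limitGraph hL'.isClosed hru (by linarith) (by linarith)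
  · rw [hqr] at hq
    linarith

lemma MeetsNonmeagrely.isLine {L G : Set (ℝ × ℝ)} (h : MeetsNonmeagrely L G) : IsLine L := by
  obtain ⟨p, v, hv, rfl, -⟩ := h
  exact isLine_lineThrough p hv

lemma MeetsNonmeagrely.rot {L G : Set (ℝ × ℝ)} {θ : ℝ}
    (h : MeetsNonmeagrely L (rot θ ⁻¹' G)) : MeetsNonmeagrely (rot θ '' L) G := by
  obtain ⟨p, v, hv, rfl, h⟩ := h
  refine ⟨_, _, rot_ne_zero θ hv, rot_image_lineThrough θ p v, ?_⟩
  simpa only [mem_preimage, rot_add_smul] using h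

lemma countable_meetsNonmeagrely (u : ℕ → ℝ × ℝ) :
    {L | MeetsNonmeagrely L (limitGraph u)}.Countable := by
  choose! a b hab h using fun L (hL : MeetsNonmeagrely L (limitGraph u)) => hL.exists_fstDenseIn
  refine MapsTo.countable_of_injOn (f := fun L => (a L, b L)) (mapsTo_univ _ _) ?_
    (to_countable univ)
  intro L hL L' hL' hLL'
  obtain ⟨ha, hb⟩ := Prod.mk.inj hLL'
  refine eq_of_fstDenseIn hL.isLine hL'.isLine (hab L hL) (h L hL) ?_
  rw [ha, hb]
  exact h L' hL'

lemma countable_meetsNonmeagrely_rot (u : ℕ → ℝ × ℝ) (θ : ℝ) :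
    {L | MeetsNonmeagrely L (rot θ ⁻¹' limitGraph u)}.Countable :=
  MapsTo.countable_of_injOn (f := image (rot θ)) (fun _ hL => MeetsNonmeagrely.rot hL)
    (rot_injective θ).image_injective.injOn (countable_meetsNonmeagrely u)

/-! ### Extending partial two-point sets -/

lemma IsPartialTwoPointSet.insert {X : Set (ℝ × ℝ)} (hX : IsPartialTwoPointSet X) {q : ℝ × ℝ}
    (hq : ∀ x ∈ X, ∀ y ∈ X, x ≠ y → q ∉ lineThrough x (y - x)) :
    IsPartialTwoPointSet (Insert.insert q X) := by
  intro L hL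
  by_cases hqL : q ∈ L
  · have h : (X ∩ L).encard ≤ 1 := by
      rw [encard_le_one_iff]
      intro x y hx hy
      by_contra hxy
      exact hq x hx.1 y hy.1 hxy (hL.eq_lineThrough hx.2 hy.2 hxy ▸ hqL)
    rw [insert_inter_of_mem hqL]
    calc (Insert.insert q (X ∩ L)).encard ≤ (X ∩ L).encard + 1 := encard_insert_le _ _
      _ ≤ 1 + 1 := by gcongr
      _ = 2 := one_add_one_eq_two
  · rw [insert_inter_of_notMem hqL]
    exact hX L hL

lemma exists_insert_isPartialTwoPointSet (hcov : CovMeagerEqContinuum) {X : Set (ℝ × ℝ)}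
    (hX : #X < 𝔠) (hXT : IsPartialTwoPointSet X) {p v : ℝ × ℝ} (hv : v ≠ 0)
    (hXL : (X ∩ lineThrough p v).encard ≤ 1) {J : Type} (hJ : #J < 𝔠) (B : J → Set (ℝ × ℝ))
    (hB : ∀ j, IsMeagre {t : ℝ | p + t • v ∈ B j}) :
    ∃ q ∈ lineThrough p v, q ∉ X ∧ (∀ j, q ∉ B j) ∧ IsPartialTwoPointSet (insert q X) := by
  let A : X ⊕ (X × X) ⊕ J → Set ℝ :=
    Sum.elim (fun x => {t | p + t • v = x}) <|
      Sum.elim (fun xy => {t | xy.1 ≠ xy.2 ∧ p + t • v ∈ lineThrough xy.1.1 (xy.2.1 - xy.1.1)})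
        fun j => {t | p + t • v ∈ B j}
  have hinj := lineThrough_injective p hv
  have hA : ∀ i, IsMeagre (A i) := by
    rintro (x | ⟨x, y⟩ | j)
    · exact Set.Subsingleton.isMeagre_real fun s hs t ht => hinj (hs.trans ht.symm)
    · refine Set.Subsingleton.isMeagre_real fun s hs t ht => ?_
      by_contra hst
      have hxy : x.1 ≠ y.1 := fun h => hs.1 (Subtype.ext h)
      have hline := (isLine_lineThrough x.1 (sub_ne_zero.2 hxy.symm)).eq_of_mem
        (isLine_lineThrough p hv) hs.2 ht.2 ⟨s, rfl⟩ ⟨t, rfl⟩ fun h => hst (hinj h)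
      refine hxy (encard_le_one_iff.1 hXL x y ⟨x.2, ?_⟩ ⟨y.2, ?_⟩) <;> rw [← hline]
      · exact ⟨0, by simp⟩
      · exact ⟨1, by simp⟩
    · exact hB j
  have hcard : #(X ⊕ (X × X) ⊕ J) < 𝔠 := by
    have h0 := aleph0_le_continuum
    simpa using add_lt_of_lt h0 hX (add_lt_of_lt h0 (mul_lt_of_lt h0 hX hX) hJ)
  obtain ⟨t, ht⟩ := (ne_univ_iff_exists_notMem _).1 (hcov _ A hcard hA)
  rw [mem_iUnion, not_exists] at ht
  refine ⟨p + t • v, ⟨t, rfl⟩, fun h => ht (.inl ⟨_, h⟩) rfl,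
    fun j => ht (.inr (.inr j)), hXT.insert fun x hx y hy hxy h => ?_⟩
  exact ht (.inr (.inl (⟨x, hx⟩, ⟨y, hy⟩))) ⟨fun h' => hxy (congrArg Subtype.val h'), h⟩

lemma exists_union_isPartialTwoPointSet (hcov : CovMeagerEqContinuum) {X : Set (ℝ × ℝ)}
    (hX : #X < 𝔠) (hXT : IsPartialTwoPointSet X) {p v : ℝ × ℝ} (hv : v ≠ 0) {J : Type}
    (hJ : #J < 𝔠) (B : J → Set (ℝ × ℝ)) (hB : ∀ j, IsMeagre {t : ℝ | p + t • v ∈ B j}) :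
    ∃ Y ⊆ lineThrough p v, Y.Finite ∧ (∀ j, Disjoint Y (B j)) ∧
      IsPartialTwoPointSet (X ∪ Y) ∧ 2 ≤ ((X ∪ Y) ∩ lineThrough p v).encard := by
  by_cases h : (X ∩ lineThrough p v).encard ≤ 1
  swap
  · exact ⟨∅, by simp, finite_empty, by simp, by simpa using hXT,
      by simpa [one_add_one_eq_two] using Order.add_one_le_of_lt (not_le.1 h)⟩
  obtain ⟨q, hqL, hqX, hqB, hq⟩ := exists_insert_isPartialTwoPointSet hcov hX hXT hv h hJ B hB
  by_cases h' : (insert q X ∩ lineThrough p v).encard ≤ 1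
  swap
  · exact ⟨{q}, by simpa using hqL, finite_singleton q, by simpa using hqB,
      by simpa using hq, by simpa [one_add_one_eq_two] using Order.add_one_le_of_lt (not_le.1 h')⟩
  have hqc : #↥(insert q X) < 𝔠 :=
    mk_insert_le.trans_lt (add_lt_of_lt aleph0_le_continuum hX
      (one_lt_aleph0.trans_le aleph0_le_continuum))
  obtain ⟨r, hrL, hrX, hrB, hr⟩ := exists_insert_isPartialTwoPointSet hcov hqc hq hv h' hJ B hB
  have hXY : X ∪ {r, q} = insert r (insert q X) := by ext; simp
  refine ⟨{r, q}, by simp [insert_subset_iff, hrL, hqL], toFinite _, by simp [hrB, hqB],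
    hXY ▸ hr, ?_⟩
  have hne : r ≠ q := fun h => hrX (h ▸ mem_insert _ _)
  rw [hXY, ← encard_pair hne]
  exact encard_le_encard (by simp [insert_subset_iff, hrL, hqL])

/-! ### Transfinite recursion -/

lemma exists_transfinite_union {ι α : Type*} [LinearOrder ι] [WellFoundedLT ι]
    (Q : ι → Set α → Set α → Prop) (h : ∀ i X, ∃ Y, Q i X Y) :
    ∃ A : ι → Set α, ∀ i, Q i (⋃ j ∈ Iio i, A j) (A i) := by
  choose step hstep using h
  let A : ι → Set α := WellFounded.fix (wellFounded_lt (α := ι))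
    fun i A => step i (⋃ j : Iio i, A j j.2)
  refine ⟨A, fun i => ?_⟩
  have hA : A i = step i (⋃ j ∈ Iio i, A j) := by
    rw [biUnion_eq_iUnion]
    exact WellFounded.fix_eq _ _ i
  rw [hA]
  exact hstep _ _

lemma IsPartialTwoPointSet.iUnion_of_directed {κ : Type*} {X : κ → Set (ℝ × ℝ)}
    (hX : ∀ i, IsPartialTwoPointSet (X i)) (hd : Directed (· ⊆ ·) X) :
    IsPartialTwoPointSet (⋃ i, X i) := by
  intro L hL
  by_contra! h
  obtain ⟨t, ht, hcard⟩ := exists_subset_encard_eq (Order.add_one_le_of_lt h)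
  obtain ⟨x, y, z, -, -, -, rfl⟩ := encard_eq_three.1 (hcard.trans two_add_one_eq_three)
  simp only [insert_subset_iff, singleton_subset_iff, mem_inter_iff, mem_iUnion] at ht
  obtain ⟨⟨⟨i, hi⟩, hx⟩, ⟨⟨j, hj⟩, hy⟩, ⟨⟨k, hk⟩, hz⟩⟩ := ht
  obtain ⟨l, hil, hjl⟩ := hd i j
  obtain ⟨m, hlm, hkm⟩ := hd l k
  have hsub : {x, y, z} ⊆ X m ∩ L := by
    simp only [insert_subset_iff, singleton_subset_iff]
    exact ⟨⟨hlm (hil hi), hx⟩, ⟨hlm (hjl hj), hy⟩, ⟨hkm hk, hz⟩⟩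
  have hle := (encard_le_encard hsub).trans (hX m L hL)
  rw [hcard] at hle
  exact absurd hle (by decide)

lemma mk_biUnion_lt_continuum {ι α : Type} {A : ι → Set α} {s : Set ι} (hs : #s < 𝔠)
    (hA : ∀ i ∈ s, (A i).Countable) : #↥(⋃ i ∈ s, A i) < 𝔠 :=
  calc #↥(⋃ i ∈ s, A i) ≤ #s * ⨆ i : s, #(A i) := mk_biUnion_le A s
    _ ≤ #s * ℵ₀ := by
      gcongr
      exact ciSup_le' fun i => (hA i i.2).le_aleph0
    _ < 𝔠 := mul_lt_of_lt aleph0_le_continuum hs aleph0_lt_continuum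

/-- If each of continuum many sets meets only countably many lines nonmeagrely, then some
Mazurkiewicz set meets each of them in fewer than continuum many points. -/
lemma exists_isMazurkiewicz_mk_inter_lt (hcov : CovMeagerEqContinuum) {T : Type} (hT : #T = 𝔠)
    (K : T → Set (ℝ × ℝ)) (hK : ∀ i, {L | MeetsNonmeagrely L (K i)}.Countable) :
    ∃ M, IsMazurkiewicz M ∧ ∀ i, #↥(M ∩ K i) < 𝔠 := by
  let ι := Cardinal.continuum.{0}.ord.ToType
  have hι : #ι = 𝔠 := mk_ord_toType _
  have hIio : ∀ i : ι, #(Iio i) < 𝔠 := fun i => (mk_Iio_lt i (by simp [ι])).trans_eq hι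
  obtain ⟨eT⟩ : Nonempty (ι ≃ T) := Cardinal.eq.1 (hι.trans hT.symm)
  obtain ⟨d⟩ : Nonempty (ι ≃ (ℝ × ℝ) × (ℝ × ℝ)) := Cardinal.eq.1 (by simp [hι, mk_real])
  let L : ι → Set (ℝ × ℝ) := fun i => lineThrough (d i).1 (d i).2
  obtain ⟨A, hA⟩ := exists_transfinite_union
    (fun (i : ι) (X Y : Set (ℝ × ℝ)) => Y.Finite ∧
      (#X < 𝔠 → IsPartialTwoPointSet X → IsPartialTwoPointSet (X ∪ Y) ∧
        Y ⊆ L i ∧ ((d i).2 ≠ 0 → 2 ≤ ((X ∪ Y) ∩ L i).encard) ∧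
        ∀ j < i, ¬MeetsNonmeagrely (L i) (K (eT j)) → Disjoint Y (K (eT j)))) (by
    intro i X
    by_cases h : (#X < 𝔠 ∧ IsPartialTwoPointSet X) ∧ (d i).2 ≠ 0
    swap
    · refine ⟨∅, finite_empty, fun h1 h2 => ⟨by simpa using h2, by simp, fun h3 => ?_, by simp⟩⟩
      exact absurd ⟨⟨h1, h2⟩, h3⟩ h
    obtain ⟨⟨hX, hXT⟩, hv⟩ := h
    have hJ : #{j : ι // j < i ∧ ¬MeetsNonmeagrely (L i) (K (eT j))} < 𝔠 :=
      (mk_subtype_mono fun j hj => hj.1).trans_lt (hIio i)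
    obtain ⟨Y, hYL, hY, hdisj, hXY, htwo⟩ := exists_union_isPartialTwoPointSet hcov hX hXT
      (p := (d i).1) hv hJ (fun j => K (eT j)) fun j => by
        by_contra h
        exact j.2.2 ⟨_, _, hv, rfl, h⟩
    exact ⟨Y, hY, fun _ _ => ⟨hXY, hYL, fun _ => htwo, fun j hj h => hdisj ⟨j, hj, h⟩⟩⟩)
  let X : ι → Set (ℝ × ℝ) := fun i => ⋃ j ∈ Iio i, A j
  have hXcard : ∀ i, #(X i) < 𝔠 := fun i =>
    mk_biUnion_lt_continuum (hIio i) fun j _ => (hA j).1.countable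
  have hmono : Monotone fun i => X i ∪ A i := by
    intro i j hij
    rcases hij.eq_or_lt with rfl | hij
    · exact subset_rfl
    · refine subset_union_of_subset_left (union_subset ?_ ?_) _
      · exact biUnion_subset_biUnion_left (Iio_subset_Iio hij.le)
      · exact subset_biUnion_of_mem (u := A) hij
  have hXT : ∀ i, IsPartialTwoPointSet (X i) := by
    intro i
    induction i using WellFoundedLT.induction with
    | ind i ih =>
      have h : X i = ⋃ j : Iio i, (X j ∪ A j) := by
        apply subset_antisymm
        · exact iUnion₂_subset fun j hj =>
            subset_iUnion_of_subset ⟨j, hj⟩ subset_union_right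
        · exact iUnion_subset fun j => union_subset
            (biUnion_subset_biUnion_left (Iio_subset_Iio j.2.le))
            (subset_biUnion_of_mem (u := A) j.2)
      rw [h]
      exact .iUnion_of_directed (fun j => ((hA j).2 (hXcard j) (ih j j.2)).1)
        (hmono.comp (Subtype.mono_coe _)).directed_le
  have hstep := fun i => (hA i).2 (hXcard i) (hXT i)
  have hM : IsMazurkiewicz (⋃ i, (X i ∪ A i)) := by
    intro L' hL'
    refine le_antisymm (IsPartialTwoPointSet.iUnion_of_directed (fun i => (hstep i).1)
      hmono.directed_le L' hL') ?_
    obtain ⟨p, v, hv, rfl⟩ := hL'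
    obtain ⟨i, hi⟩ := d.surjective (p, v)
    have hLi : L i = lineThrough p v := by simp only [L, hi]
    refine ((hstep i).2.2.1 (by rwa [hi])).trans (encard_le_encard ?_)
    rw [hLi]
    gcongr
    exact subset_iUnion (fun i => X i ∪ A i) i
  refine ⟨_, hM, fun t => ?_⟩
  obtain ⟨i, rfl⟩ := eT.surjective t
  set M := ⋃ i, (X i ∪ A i)
  have hsub : M ∩ K (eT i) ⊆ (X i ∪ A i) ∪
      ⋃ L' ∈ {L' | MeetsNonmeagrely L' (K (eT i))}, M ∩ L' := by
    rintro q ⟨hqM, hqK⟩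
    obtain ⟨j, hj⟩ : ∃ j, q ∈ A j := by
      obtain ⟨k, hk | hk⟩ := mem_iUnion.1 hqM
      · obtain ⟨j, -, hj⟩ := mem_iUnion₂.1 hk
        exact ⟨j, hj⟩
      · exact ⟨k, hk⟩
    rcases le_or_gt j i with hji | hij
    · exact Or.inl (hmono hji (Or.inr hj))
    · have hbig : MeetsNonmeagrely (L j) (K (eT i)) := by
        by_contra h
        exact disjoint_left.1 ((hstep j).2.2.2 i hij h) hj hqK
      exact Or.inr (mem_biUnion (x := L j) hbig ⟨hqM, (hstep j).2.1 hj⟩)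
  have hcount : (⋃ L' ∈ {L' | MeetsNonmeagrely L' (K (eT i))}, M ∩ L').Countable := by
    refine (hK (eT i)).biUnion fun L' hL' => ?_
    exact (finite_of_encard_eq_coe (hM L' hL'.isLine)).countable
  refine (mk_le_mk_of_subset hsub).trans_lt ((mk_union_le _ _).trans_lt
    (add_lt_of_lt aleph0_le_continuum ((mk_union_le _ _).trans_lt ?_) ?_))
  · exact add_lt_of_lt aleph0_le_continuum (hXcard i)
      ((hA i).1.lt_aleph0.trans_le aleph0_le_continuum)
  · exact hcount.le_aleph0.trans_lt aleph0_lt_continuum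

/-- Assuming `cov(ℳ) = 𝔠`, there is a Mazurkiewicz set whose every rotation is both
a Mazurkiewicz set and a Sierpiński–Zygmund set. -/
theorem stmt_13 (hcov : CovMeagerEqContinuum) :
    ∃ M : Set (ℝ × ℝ), IsMazurkiewicz M ∧
      ∀ θ : ℝ, IsMazurkiewicz (rot θ '' M) ∧ IsSZSet (rot θ '' M) := by
  obtain ⟨M, hM, hMK⟩ := exists_isMazurkiewicz_mk_inter_lt hcov
    (T := (ℕ → ℝ × ℝ) × ℝ) (by simp [mk_real]) (fun i => rot i.2 ⁻¹' limitGraph i.1)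
    fun i => countable_meetsNonmeagrely_rot i.1 i.2
  refine ⟨M, hM, fun θ => ⟨hM.rot θ, fun S g hg => ?_⟩⟩
  obtain ⟨u, hu⟩ := exists_graphOn_subset_limitGraph S g hg
  have hsub : rot θ '' M ∩ graphOn S g ⊆ rot θ '' (M ∩ rot θ ⁻¹' limitGraph u) := by
    rintro _ ⟨⟨q, hq, rfl⟩, hqg⟩
    exact ⟨q, ⟨hq, hu hqg⟩, rfl⟩
  exact (mk_le_mk_of_subset hsub).trans_lt (mk_image_le.trans_lt (hMK (u, θ)))
end
end

section
/- Let M ⊆ ℝ × ℝ be a Mazurkiewicz set and let D ⊆ M be a set that is linearly independent over ℚ. Let V be the collection of all vertical lines ℓ of ℝ² such that ℓ ∩ M is contained in the ℚ-linear span of D. If the cardinality of D is strictly less than the cardinality of V, then M does not contain the graph of any Hamel function, i.e., there is no Hamel function h : ℝ → ℝ with {(x, h x) | x ∈ ℝ} ⊆ M. -/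
open Cardinal Set

noncomputable section

/-- A set of vertical lines, each of which meets the graph of `h` in a point of `span ℚ D`, is no
larger than `D` when the graph of `h` is linearly independent over `ℚ`. -/
theorem mk_verticalLines_le_of_graph_linearIndependent {D : Set (ℝ × ℝ)} {h : ℝ → ℝ}
    (hh : LinearIndependent ℚ ((↑) : graphOf h → ℝ × ℝ)) {V : Set (Set (ℝ × ℝ))}
    (hV : ∀ L ∈ V, ∃ x : ℝ, L = {p : ℝ × ℝ | p.1 = x} ∧ (x, h x) ∈ Submodule.span ℚ D) :
    #↥V ≤ #↥D := by
  choose x hxL hxD using fun L : V => hV L L.2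
  have hx : Function.Injective x := fun L₁ L₂ e => Subtype.ext (by rw [hxL L₁, hxL L₂, e])
  have hli : LinearIndependent ℚ fun L : V => (x L, h (x L)) :=
    hh.comp (fun L : V => (⟨(x L, h (x L)), x L, rfl⟩ : graphOf h)) fun L₁ L₂ e =>
      hx (congrArg (fun p : graphOf h => p.1.1) e)
  have hspan : LinearIndependent ℚ
      fun L : V => (⟨(x L, h (x L)), hxD L⟩ : Submodule.span ℚ D) :=
    .of_comp (Submodule.span ℚ D).subtype hli
  exact hspan.cardinal_le_rank.trans (rank_span_le D)

/-- If a Mazurkiewicz set `M` contains a ℚ-linearly independent set `D` such that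
strictly more vertical lines meet `M` inside `span_ℚ D` than `D` has elements,
then `M` contains no graph of a Hamel function. -/
theorem stmt_16 (M D : Set (ℝ × ℝ)) (hM : IsMazurkiewicz M) (hDM : D ⊆ M)
    (hind : LinearIndependent ℚ ((↑) : D → ℝ × ℝ))
    (V : Set (Set (ℝ × ℝ)))
    (hV : V = {L : Set (ℝ × ℝ) | IsVerticalLine L ∧
      L ∩ M ⊆ (Submodule.span ℚ D : Set (ℝ × ℝ))})
    (hcard : #↥D < #↥V) :
    ¬ ∃ h : ℝ → ℝ, IsHamelFun h ∧ graphOf h ⊆ M := by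
  rintro ⟨h, ⟨hh, -⟩, hhM⟩
  refine hcard.not_ge (mk_verticalLines_le_of_graph_linearIndependent hh fun L hL => ?_)
  rw [hV] at hL
  obtain ⟨⟨x, rfl⟩, hLD⟩ := hL
  exact ⟨x, rfl, hLD ⟨rfl, hhM ⟨x, rfl⟩⟩⟩
end
end

section
/- If M ⊆ ℝ × ℝ is a Mazurkiewicz set containing the six points (0,0), (0,1), (1,0), (1,2), (3,1), (3,2), then M does not contain the graph of any Hamel function, i.e., there is no Hamel function h : ℝ → ℝ with {(x, h x) | x ∈ ℝ} ⊆ M. -/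
open Cardinal Set

noncomputable section

/-- Two distinct points of a Mazurkiewicz set on a common vertical line are its only points on
that line. -/
theorem IsMazurkiewicz.eq_or_eq_of_vertical {M : Set (ℝ × ℝ)} (hM : IsMazurkiewicz M)
    {x a b c : ℝ} (ha : (x, a) ∈ M) (hb : (x, b) ∈ M) (hab : a ≠ b) (hc : (x, c) ∈ M) :
    c = a ∨ c = b := by
  by_contra! hne
  have hsub : ({(x, a), (x, b), (x, c)} : Set (ℝ × ℝ)) ⊆ M ∩ lineThrough (x, 0) (0, 1) := by
    rintro p (rfl | rfl | rfl)
    · exact ⟨ha, a, by simp⟩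
    · exact ⟨hb, b, by simp⟩
    · exact ⟨hc, c, by simp⟩
  have hcard := Set.encard_le_encard hsub
  rw [hM _ ⟨(x, 0), (0, 1), by simp, rfl⟩,
    Set.encard_eq_three.mpr ⟨(x, a), (x, b), (x, c), by simpa using hab,
      by simpa using hne.1.symm, by simpa using hne.2.symm, rfl⟩] at hcard
  exact absurd hcard (by decide)

/-- The points of the graph of a Hamel function are rationally independent, indexed by their
abscissas. -/
theorem IsHamelFun.linearIndependent {h : ℝ → ℝ} (hh : IsHamelFun h) :
    LinearIndependent ℚ (fun x : ℝ => (x, h x)) :=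
  LinearIndependent.comp hh.1 (fun x : ℝ => (⟨(x, h x), x, rfl⟩ : graphOf h))
    fun _ _ hxy => congrArg (fun p : graphOf h => p.1.1) hxy

/-- A Hamel function with value `1` at `0` does not take rational values at both `1` and `3`. -/
theorem IsHamelFun.not_rational_values {h : ℝ → ℝ} (hh : IsHamelFun h) {a b : ℚ}
    (h0 : h 0 = 1) (h1 : h 1 = a) (h3 : h 3 = b) : False := by
  have hinj : Function.Injective (![0, 1, 3] : Fin 3 → ℝ) := by
    intro i j hij
    fin_cases i <;> fin_cases j <;> simp_all
  have hli := hh.linearIndependent.comp _ hinj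
  have hzero := Fintype.linearIndependent_iff.mp hli ![b - 3 * a, 3, -1] (by
    simp [Fin.sum_univ_three, h0, h1, h3, Rat.smul_def]) 1
  simp at hzero

/-- A Mazurkiewicz set containing the six points `(0,0)`, `(0,1)`, `(1,0)`, `(1,2)`,
`(3,1)`, `(3,2)` contains no graph of a Hamel function. -/
theorem stmt_17 (M : Set (ℝ × ℝ)) (hM : IsMazurkiewicz M)
    (h1 : ((0 : ℝ), (0 : ℝ)) ∈ M) (h2 : ((0 : ℝ), (1 : ℝ)) ∈ M)
    (h3 : ((1 : ℝ), (0 : ℝ)) ∈ M) (h4 : ((1 : ℝ), (2 : ℝ)) ∈ M)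
    (h5 : ((3 : ℝ), (1 : ℝ)) ∈ M) (h6 : ((3 : ℝ), (2 : ℝ)) ∈ M) :
    ¬ ∃ h : ℝ → ℝ, IsHamelFun h ∧ graphOf h ⊆ M := by
  rintro ⟨h, hh, hsub⟩
  have hmem : ∀ x, (x, h x) ∈ M := fun x => hsub ⟨x, rfl⟩
  have h0 : h 0 = 1 := by
    rcases hM.eq_or_eq_of_vertical h1 h2 (by norm_num) (hmem 0) with h0 | h0
    · exact absurd (by simp [h0]) (hh.linearIndependent.ne_zero 0)
    · exact h0
  rcases hM.eq_or_eq_of_vertical h3 h4 (by norm_num) (hmem 1) with ha | ha <;>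
    rcases hM.eq_or_eq_of_vertical h5 h6 (by norm_num) (hmem 3) with hb | hb
  · exact hh.not_rational_values (a := 0) (b := 1) h0 (by simpa using ha) (by simpa using hb)
  · exact hh.not_rational_values (a := 0) (b := 2) h0 (by simpa using ha) (by simpa using hb)
  · exact hh.not_rational_values (a := 2) (b := 1) h0 (by simpa using ha) (by simpa using hb)
  · exact hh.not_rational_values (a := 2) (b := 2) h0 (by simpa using ha) (by simpa using hb)
end
end

section
/- There exist bijections f g : ℝ → ℝ such that both f and g are Hamel functions, their graphs are disjoint, and the union {(x, f x) | x ∈ ℝ} ∪ {(x, g x) | x ∈ ℝ} is a Mazurkiewicz set. -/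
open Cardinal Set

noncomputable section

/-! ### Transfinite extension -/

lemma mk_iUnion_lt_continuum {ι X : Type} {f : ι → Set X} (hι : #ι < 𝔠)
    (hf : ∀ i, (f i).Finite) : #(⋃ i, f i) < 𝔠 := by
  refine (mk_iUnion_le f).trans_lt (mul_lt_of_lt aleph0_le_continuum hι ?_)
  refine lt_of_le_of_lt (ciSup_le' fun i => ?_) aleph0_lt_continuum
  exact ((hf i).lt_aleph0).le

/-- A hereditary property of sets of finite character, such that each of at most continuum many
requirements can be met by adding finitely many elements to any small set with the property,
admits a set with the property that meets all requirements. -/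
theorem exists_forall_of_finite_extension {X T : Type} (hT : #T ≤ 𝔠) (Good : Set X → Prop)
    (Done : T → Set X → Prop) (good_mono : ∀ S S' : Set X, S ⊆ S' → Good S' → Good S)
    (good_of_finset : ∀ S : Set X, (∀ A : Finset X, (A : Set X) ⊆ S → Good A) → Good S)
    (done_mono : ∀ t, ∀ S S' : Set X, S ⊆ S' → Done t S → Done t S') (good_empty : Good ∅)
    (step : ∀ S : Set X, Good S → #S < 𝔠 → ∀ t,
      ∃ A : Finset X, Good (S ∪ A) ∧ Done t (S ∪ A)) :
    ∃ S, Good S ∧ ∀ t, Done t S := by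
  classical
  have step' : ∀ t, ∀ S : Set X, ∃ A : Finset X,
      Good S → #S < 𝔠 → Good (S ∪ A) ∧ Done t (S ∪ A) := by
    intro t S
    by_cases h : Good S ∧ #S < 𝔠
    · obtain ⟨A, hA⟩ := step S h.1 h.2 t
      exact ⟨A, fun _ _ => hA⟩
    · exact ⟨∅, fun h1 h2 => absurd ⟨h1, h2⟩ h⟩
  choose pick hpick using step'
  obtain ⟨r, wo, hr⟩ := Cardinal.exists_ord_eq T
  have wf : WellFounded r := wo.wf
  let A : T → Finset X := wf.fix fun t ih => pick t (⋃ s : {s // r s t}, (ih s.1 s.2 : Set X))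
  let S : T → Set X := fun t => ⋃ s : {s // r s t}, (A s.1 : Set X)
  have hA : ∀ t, A t = pick t (S t) := fun t => wf.fix_eq _ t
  have hS : ∀ t, #(S t) < 𝔠 := fun t =>
    mk_iUnion_lt_continuum
      (by rw [← Ordinal.card_typein]; exact (card_typein_lt t hr).trans_le hT)
      (fun s => (A s.1).finite_toSet)
  have hSA : ∀ s t, r s t → S s ∪ A s ⊆ S t ∪ A t := by
    intro s t hst
    refine subset_union_of_subset_left (union_subset (iUnion_subset fun u => ?_) ?_) _
    · exact subset_iUnion (fun v : {v // r v t} => (A v.1 : Set X)) ⟨u.1, trans_of r u.2 hst⟩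
    · exact subset_iUnion (fun v : {v // r v t} => (A v.1 : Set X)) ⟨s, hst⟩
  have good_union : ∀ c : Set T, (∀ t ∈ c, Good (S t ∪ A t)) → Good (⋃ t ∈ c, (A t : Set X)) := by
    intro c hc
    rcases c.eq_empty_or_nonempty with rfl | hne
    · simpa using good_empty
    refine good_of_finset _ fun B hB => ?_
    have hdir : DirectedOn (fun i j => S i ∪ A i ⊆ S j ∪ A j) c := by
      intro i hi j hj
      rcases trichotomous_of r i j with h | h | h
      · exact ⟨j, hj, hSA _ _ h, subset_rfl⟩
      · exact ⟨j, hj, h ▸ subset_rfl, subset_rfl⟩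
      · exact ⟨i, hi, subset_rfl, hSA _ _ h⟩
    obtain ⟨i, hi, hBi⟩ := hdir.exists_mem_subset_of_finset_subset_biUnion
      (f := fun t => S t ∪ A t) hne
      (hB.trans (iUnion₂_mono fun t _ => subset_union_right))
    exact good_mono _ _ hBi (hc i hi)
  have hgood : ∀ t, Good (S t ∪ A t) ∧ Done t (S t ∪ A t) := by
    intro t
    induction t using wf.induction with
    | _ t ih =>
      have h := good_union {s | r s t} fun s hs => (ih s hs).1
      have hSt : S t = ⋃ s ∈ {s | r s t}, (A s : Set X) := by
        ext x; simp [S]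
      rw [← hSt] at h
      rw [hA]
      exact hpick t (S t) h (hS t)
  refine ⟨⋃ t ∈ (univ : Set T), (A t : Set X), good_union _ fun t _ => (hgood t).1, fun t => ?_⟩
  refine done_mono t _ _ (union_subset ?_ ?_) (hgood t).2
  · exact iUnion_subset fun s => subset_biUnion_of_mem (u := fun t => (A t : Set X)) (mem_univ s.1)
  · exact subset_biUnion_of_mem (u := fun t => (A t : Set X)) (mem_univ t)

/-! ### Small sets of reals -/

lemma mk_union_lt_continuum {X : Type} {A B : Set X} (hA : #A < 𝔠) (hB : #B < 𝔠) :
    #(A ∪ B : Set X) < 𝔠 :=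
  (mk_union_le A B).trans_lt (add_lt_of_lt aleph0_le_continuum hA hB)

lemma mk_span_rat_lt_continuum {V : Type} [AddCommGroup V] [Module ℚ V] {s : Set V}
    (hs : #s < 𝔠) : #(Submodule.span ℚ s) < 𝔠 := by
  have h : #(Submodule.span ℚ s) ≤ #(s →₀ ℚ) := by
    have := Finsupp.range_linearCombination (R := ℚ) (v := ((↑) : s → V))
    rw [Subtype.range_coe] at this
    rw [← this]
    exact mk_range_le
  refine h.trans_lt ?_
  rcases isEmpty_or_nonempty s with he | hne
  · exact lt_of_le_of_lt (mk_le_aleph0 (α := s →₀ ℚ)) aleph0_lt_continuum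
  · rw [mk_finsupp_of_infinite']
    simp [hs, aleph0_lt_continuum]

lemma exists_notMem_of_mk_lt_continuum {A : Set ℝ} (hA : #A < 𝔠) : ∃ t, t ∉ A := by
  by_contra! h
  rw [eq_univ_of_forall h, mk_univ, mk_real] at hA
  exact hA.false

lemma finite_quadratic_roots {a b c : ℝ} (h : ¬(a = 0 ∧ b = 0 ∧ c = 0)) :
    {t : ℝ | a * t ^ 2 + b * t + c = 0}.Finite := by
  classical
  let P : Polynomial ℝ :=
    Polynomial.C a * Polynomial.X ^ 2 + Polynomial.C b * Polynomial.X + Polynomial.C c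
  have hP : P ≠ 0 := by
    intro h0
    refine h ⟨?_, ?_, ?_⟩
    · simpa [P, Polynomial.coeff_X, Polynomial.coeff_C] using congrArg (fun q => q.coeff 2) h0
    · simpa [P, Polynomial.coeff_X, Polynomial.coeff_C] using congrArg (fun q => q.coeff 1) h0
    · simpa [P, Polynomial.coeff_X, Polynomial.coeff_C] using congrArg (fun q => q.coeff 0) h0
  refine (P.roots.toFinset.finite_toSet).subset fun t ht => ?_
  have ht : a * t ^ 2 + b * t + c = 0 := ht
  simpa [P, hP] using ht

/-! ### Partial constructions -/

/-- Twice the signed area of the triangle `p q r`. -/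
def cross (p q r : ℝ × ℝ) : ℝ := (q.1 - p.1) * (r.2 - p.2) - (q.2 - p.2) * (r.1 - p.1)

/-- The points of colour `b` in a set of coloured points. -/
def layer (S : Set (Bool × ℝ × ℝ)) (b : Bool) : Set (ℝ × ℝ) := {p | (b, p) ∈ S}

/-- The two layers of `S` are disjoint rationally independent graphs of partial injections, and
no three points of their union are collinear. -/
structure IsPartialPair (S : Set (Bool × ℝ × ℝ)) : Prop where
  point_ne : ∀ x ∈ S, ∀ y ∈ S, x ≠ y → x.2 ≠ y.2
  cross_ne : ∀ x ∈ S, ∀ y ∈ S, ∀ z ∈ S, x ≠ y → x ≠ z → y ≠ z → cross x.2 y.2 z.2 ≠ 0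
  coord_ne : ∀ x ∈ S, ∀ y ∈ S, x.1 = y.1 → x ≠ y → x.2.1 ≠ y.2.1 ∧ x.2.2 ≠ y.2.2
  indep : ∀ b, LinearIndepOn ℚ id (layer S b)

namespace IsPartialPair

variable {S : Set (Bool × ℝ × ℝ)}

lemma mono {S' : Set (Bool × ℝ × ℝ)} (h : S ⊆ S') (hS : IsPartialPair S') : IsPartialPair S where
  point_ne x hx y hy := hS.point_ne x (h hx) y (h hy)
  cross_ne x hx y hy z hz := hS.cross_ne x (h hx) y (h hy) z (h hz)
  coord_ne x hx y hy := hS.coord_ne x (h hx) y (h hy)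
  indep b := (hS.indep b).mono fun _ hp => h hp

lemma of_finset (h : ∀ A : Finset (Bool × ℝ × ℝ), (A : Set (Bool × ℝ × ℝ)) ⊆ S →
    IsPartialPair (A : Set (Bool × ℝ × ℝ))) : IsPartialPair S where
  point_ne x hx y hy := by
    classical
    exact (h {x, y} (by simp [insert_subset_iff, hx, hy])).point_ne x (by simp) y (by simp)
  cross_ne x hx y hy z hz := by
    classical
    exact (h {x, y, z} (by simp [insert_subset_iff, hx, hy, hz])).cross_ne
      x (by simp) y (by simp) z (by simp)
  coord_ne x hx y hy := by
    classical
    exact (h {x, y} (by simp [insert_subset_iff, hx, hy])).coord_ne x (by simp) y (by simp)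
  indep b := by
    classical
    rw [linearIndepOn_iff_linearIndepOn_finset]
    intro t ht
    have hsub : ((t.image (Prod.mk b) : Finset _) : Set (Bool × ℝ × ℝ)) ⊆ S := by
      intro x hx
      obtain ⟨p, hp, rfl⟩ := Finset.mem_image.1 (Finset.mem_coe.1 hx)
      exact ht hp
    refine ((h _ hsub).indep b).mono fun p hp => ?_
    simpa [layer] using hp

lemma empty : IsPartialPair ∅ where
  point_ne := by simp
  cross_ne := by simp
  coord_ne := by simp
  indep b := by simp [layer]

lemma cross_rotate (p q r : ℝ × ℝ) : cross p q r = cross q r p := by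
  unfold cross; ring

lemma cross_swap (p q r : ℝ × ℝ) : cross p q r = -cross q p r := by
  unfold cross; ring

lemma layer_insert_self (b : Bool) (q : ℝ × ℝ) :
    layer (insert (b, q) S) b = insert q (layer S b) := by
  ext p; simp [layer]

lemma insert_point (hS : IsPartialPair S) {b : Bool} {q : ℝ × ℝ}
    (hcross : ∀ x ∈ S, ∀ y ∈ S, x ≠ y → cross x.2 y.2 q ≠ 0)
    (hne : ∀ x ∈ S, x.2 ≠ q)
    (hcoord : ∀ x ∈ S, x.1 = b → x.2.1 ≠ q.1 ∧ x.2.2 ≠ q.2)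
    (hspan : q ∉ Submodule.span ℚ (layer S b)) : IsPartialPair (insert (b, q) S) where
  point_ne := by
    rintro x (rfl | hx) y (rfl | hy) hxy
    · exact absurd rfl hxy
    · exact (hne y hy).symm
    · exact hne x hx
    · exact hS.point_ne x hx y hy hxy
  cross_ne := by
    rintro x (rfl | hx) y (rfl | hy) z (rfl | hz) hxy hxz hyz
    · exact absurd rfl hxy
    · exact absurd rfl hxy
    · exact absurd rfl hxz
    · rw [cross_rotate]; exact hcross y hy z hz hyz
    · exact absurd rfl hyz
    · rw [← cross_rotate]; exact hcross z hz x hx hxz.symm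
    · exact hcross x hx y hy hxy
    · exact hS.cross_ne x hx y hy z hz hxy hxz hyz
  coord_ne := by
    rintro x (rfl | hx) y (rfl | hy) hb hxy
    · exact absurd rfl hxy
    · exact ⟨(hcoord y hy hb.symm).1.symm, (hcoord y hy hb.symm).2.symm⟩
    · exact hcoord x hx hb
    · exact hS.coord_ne x hx y hy hb hxy
  indep b' := by
    by_cases h : b' = b
    · subst h
      rw [layer_insert_self]
      exact (hS.indep b').insert (by simpa using hspan)
    · have : layer (insert (b, q) S) b' = layer S b' := by
        ext p; simp [layer, h]
      rw [this]
      exact hS.indep b'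

end IsPartialPair

lemma mk_layer_lt_continuum {S : Set (Bool × ℝ × ℝ)} (hS : #S < 𝔠) (b : Bool) :
    #(layer S b) < 𝔠 :=
  (mk_preimage_of_injective (Prod.mk b) S (Prod.mk_right_injective b)).trans_lt hS

/-- The parameters at which an injective curve meets a small set form a small set. -/
lemma mk_preimage_lt_continuum {γ : ℝ → ℝ × ℝ} (hγ : Function.Injective γ) {A : Set (ℝ × ℝ)}
    (hA : #A < 𝔠) : #(γ ⁻¹' A) < 𝔠 :=
  (mk_preimage_of_injective γ A hγ).trans_lt hA

lemma mk_setOf_exists_lt_continuum {X : Type} {S : Set X} (hS : #S < 𝔠) {B : X → ℝ → Prop}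
    (hB : ∀ x ∈ S, {t | B x t}.Finite) : #{t | ∃ x ∈ S, B x t} < 𝔠 := by
  have : {t | ∃ x ∈ S, B x t} = ⋃ x : S, {t | B x t} := by ext t; simp
  rw [this]
  exact mk_iUnion_lt_continuum hS fun x => hB x x.2

lemma mk_setOf_exists_pair_lt_continuum {X : Type} {S : Set X} (hS : #S < 𝔠)
    {B : X → X → ℝ → Prop} (hB : ∀ x ∈ S, ∀ y ∈ S, x ≠ y → {t | B x y t}.Finite) :
    #{t | ∃ x ∈ S, ∃ y ∈ S, x ≠ y ∧ B x y t} < 𝔠 := by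
  have : {t | ∃ x ∈ S, ∃ y ∈ S, x ≠ y ∧ B x y t} =
      ⋃ x : S × S, {t | (x.1 : X) ≠ x.2 ∧ B x.1 x.2 t} := by
    ext t; simp; grind
  rw [this]
  refine mk_iUnion_lt_continuum ?_ fun x => ?_
  · rw [← mul_def]; exact mul_lt_of_lt aleph0_le_continuum hS hS
  · by_cases h : (x.1 : X) = x.2
    · simp only [h, ne_eq, not_true_eq_false, false_and, ofPred_false, finite_empty]
    · exact (hB x.1 x.1.2 x.2 x.2.2 h).subset fun t ht => ht.2

/-- The point `q` lies on the line through `p` with direction `v`. -/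
def OnLine (p v q : ℝ × ℝ) : Prop := v.1 * (q.2 - p.2) - v.2 * (q.1 - p.1) = 0

/-- A line on which a partial pair leaves room for one more point of colour `b` contains a point
by which the pair can be enlarged. -/
lemma IsPartialPair.exists_insert_onLine {S : Set (Bool × ℝ × ℝ)} (hS : IsPartialPair S)
    (hcard : #S < 𝔠) (b : Bool) {p v : ℝ × ℝ} (hv : v ≠ 0)
    (hL : ∀ x ∈ S, ∀ y ∈ S, OnLine p v x.2 → OnLine p v y.2 → x = y)
    (hvert : v.1 = 0 → ∀ x ∈ S, x.1 = b → x.2.1 ≠ p.1)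
    (hhor : v.2 = 0 → ∀ x ∈ S, x.1 = b → x.2.2 ≠ p.2) :
    ∃ q, OnLine p v q ∧ (∀ x ∈ S, x.2 ≠ q) ∧ IsPartialPair (insert (b, q) S) := by
  let γ : ℝ → ℝ × ℝ := fun t => (p.1 + t * v.1, p.2 + t * v.2)
  have hγ : Function.Injective γ := by
    intro s t hst
    obtain ⟨e1, e2⟩ := Prod.mk.inj hst
    by_contra hne
    have hne' : s - t ≠ 0 := sub_ne_zero.2 hne
    refine hv (Prod.ext ?_ ?_)
    · exact (mul_eq_zero.1 (show (s - t) * v.1 = 0 by linear_combination e1)).resolve_left hne'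
    · exact (mul_eq_zero.1 (show (s - t) * v.2 = 0 by linear_combination e2)).resolve_left hne'
  have hcross : #{t | ∃ x ∈ S, ∃ y ∈ S, x ≠ y ∧ cross x.2 y.2 (γ t) = 0} < 𝔠 := by
    refine mk_setOf_exists_pair_lt_continuum hcard fun x hx y hy hxy => ?_
    refine (finite_quadratic_roots (a := 0)
      (b := (y.2.1 - x.2.1) * v.2 - (y.2.2 - x.2.2) * v.1) (c := cross x.2 y.2 p) ?_).subset ?_
    · rintro ⟨-, h1, h2⟩
      unfold cross at h2
      have hd : y.2.1 - x.2.1 ≠ 0 ∨ y.2.2 - x.2.2 ≠ 0 := by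
        by_contra! h
        exact hS.point_ne x hx y hy hxy
          (Prod.ext (sub_eq_zero.1 h.1).symm (sub_eq_zero.1 h.2).symm)
      have hon : OnLine p v x.2 := by
        unfold OnLine
        rcases hd with h | h
        · refine (mul_eq_zero.1 ?_).resolve_left h
          linear_combination (p.1 - x.2.1) * h1 - v.1 * h2
        · refine (mul_eq_zero.1 ?_).resolve_left h
          linear_combination (p.2 - x.2.2) * h1 - v.2 * h2
      refine hxy (hL x hx y hy hon ?_)
      unfold OnLine at hon ⊢
      linear_combination hon - h1
    · intro t ht
      have ht : cross x.2 y.2 (γ t) = 0 := ht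
      simp only [cross, γ] at ht
      simp only [mem_ofPred_eq, cross]
      linear_combination ht
  have hne : #{t | ∃ x ∈ S, x.2 = γ t} < 𝔠 := by
    refine mk_setOf_exists_lt_continuum hcard fun x _ => ?_
    refine ((finite_singleton x.2).preimage hγ.injOn).subset fun t ht => ?_
    exact ht.symm
  have hfst : #{t | ∃ x ∈ S, x.1 = b ∧ x.2.1 = (γ t).1} < 𝔠 := by
    refine mk_setOf_exists_lt_continuum hcard fun x hx => ?_
    by_cases hb : x.1 = b
    · refine (finite_quadratic_roots (a := 0) (b := v.1) (c := p.1 - x.2.1) ?_).subset ?_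
      · rintro ⟨-, h1, h2⟩
        exact hvert h1 x hx hb (by linarith)
      · rintro t ⟨-, ht⟩
        simp only [γ] at ht
        simp only [mem_ofPred_eq]
        linear_combination -ht
    · simp [hb]
  have hsnd : #{t | ∃ x ∈ S, x.1 = b ∧ x.2.2 = (γ t).2} < 𝔠 := by
    refine mk_setOf_exists_lt_continuum hcard fun x hx => ?_
    by_cases hb : x.1 = b
    · refine (finite_quadratic_roots (a := 0) (b := v.2) (c := p.2 - x.2.2) ?_).subset ?_
      · rintro ⟨-, h1, h2⟩
        exact hhor h1 x hx hb (by linarith)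
      · rintro t ⟨-, ht⟩
        simp only [γ] at ht
        simp only [mem_ofPred_eq]
        linear_combination -ht
    · simp [hb]
  have hspan : #(γ ⁻¹' (Submodule.span ℚ (layer S b) : Set (ℝ × ℝ))) < 𝔠 :=
    mk_preimage_lt_continuum hγ (mk_span_rat_lt_continuum (mk_layer_lt_continuum hcard b))
  obtain ⟨t, ht⟩ := exists_notMem_of_mk_lt_continuum
    (mk_union_lt_continuum hcross (mk_union_lt_continuum hne
      (mk_union_lt_continuum hfst (mk_union_lt_continuum hsnd hspan))))
  simp only [mem_union, mem_ofPred_eq, mem_preimage, not_or] at ht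
  obtain ⟨t1, t2, t3, t4, t5⟩ := ht
  refine ⟨γ t, by simp only [OnLine, γ]; ring, fun x hx h => t2 ⟨x, hx, h⟩,
    hS.insert_point ?_ ?_ ?_ t5⟩
  · exact fun x hx y hy hxy h => t1 ⟨x, hx, y, hy, hxy, h⟩
  · exact fun x hx h => t2 ⟨x, hx, h⟩
  · exact fun x hx hb => ⟨fun h => t3 ⟨x, hx, hb, h⟩, fun h => t4 ⟨x, hx, hb, h⟩⟩

/-- A partial pair can be enlarged by two points of colour `b` with any prescribed difference `w`
that is new to the span and not parallel to an axis. -/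
lemma IsPartialPair.exists_insert_sub_eq {S : Set (Bool × ℝ × ℝ)} (hS : IsPartialPair S)
    (hcard : #S < 𝔠) (b : Bool) {w : ℝ × ℝ} (hw1 : w.1 ≠ 0) (hw2 : w.2 ≠ 0)
    (hw : w ∉ Submodule.span ℚ (layer S b)) :
    ∃ p q, p - q = w ∧ IsPartialPair (insert (b, q) (insert (b, p) S)) := by
  let γ : ℝ → ℝ × ℝ := fun t => (t, t ^ 2)
  have hγ : Function.Injective γ := fun s t hst => (Prod.mk.inj hst).1
  have hcross (u : ℝ × ℝ) :
      #{t | ∃ x ∈ S, ∃ y ∈ S, x ≠ y ∧ cross x.2 y.2 (γ t - u) = 0} < 𝔠 := by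
    refine mk_setOf_exists_pair_lt_continuum hcard fun x hx y hy hxy => ?_
    refine (finite_quadratic_roots (a := y.2.1 - x.2.1) (b := -(y.2.2 - x.2.2))
      (c := (y.2.1 - x.2.1) * (-u.2 - x.2.2) - (y.2.2 - x.2.2) * (-u.1 - x.2.1)) ?_).subset ?_
    · rintro ⟨h1, h2, -⟩
      exact hS.point_ne x hx y hy hxy (Prod.ext (by linarith) (by linarith))
    · intro t ht
      have ht : cross x.2 y.2 (γ t - u) = 0 := ht
      simp only [cross, γ, Prod.fst_sub, Prod.snd_sub] at ht
      simp only [mem_ofPred_eq]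
      linear_combination ht
  have hdir : #{t | ∃ x ∈ S, cross x.2 (γ t) (γ t - w) = 0} < 𝔠 := by
    refine mk_setOf_exists_lt_continuum hcard fun x _ => ?_
    refine (finite_quadratic_roots (a := w.1) (b := -w.2)
      (c := w.2 * x.2.1 - w.1 * x.2.2) ?_).subset ?_
    · exact fun h => hw1 h.1
    · intro t ht
      have ht : cross x.2 (γ t) (γ t - w) = 0 := ht
      simp only [cross, γ, Prod.fst_sub, Prod.snd_sub] at ht
      simp only [mem_ofPred_eq]
      linear_combination ht
  have hfst (u : ℝ × ℝ) : #{t | ∃ x ∈ S, x.2.1 = (γ t - u).1} < 𝔠 := by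
    refine mk_setOf_exists_lt_continuum hcard fun x _ => ?_
    refine (finite_quadratic_roots (a := 0) (b := 1) (c := -u.1 - x.2.1) (by simp)).subset ?_
    intro t ht
    have ht : x.2.1 = (γ t - u).1 := ht
    simp only [γ, Prod.fst_sub] at ht
    simp only [mem_ofPred_eq]
    linear_combination -ht
  have hsnd (u : ℝ × ℝ) : #{t | ∃ x ∈ S, x.2.2 = (γ t - u).2} < 𝔠 := by
    refine mk_setOf_exists_lt_continuum hcard fun x _ => ?_
    refine (finite_quadratic_roots (a := 1) (b := 0) (c := -u.2 - x.2.2) (by simp)).subset ?_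
    intro t ht
    have ht : x.2.2 = (γ t - u).2 := ht
    simp only [γ, Prod.snd_sub] at ht
    simp only [mem_ofPred_eq]
    linear_combination -ht
  have hspan : #(γ ⁻¹' (Submodule.span ℚ (insert w (layer S b)) : Set (ℝ × ℝ))) < 𝔠 := by
    refine mk_preimage_lt_continuum hγ (mk_span_rat_lt_continuum (mk_insert_le.trans_lt ?_))
    exact add_lt_of_lt aleph0_le_continuum (mk_layer_lt_continuum hcard b)
      (one_lt_aleph0.trans aleph0_lt_continuum)
  obtain ⟨t, ht⟩ := exists_notMem_of_mk_lt_continuum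
    (mk_union_lt_continuum (mk_union_lt_continuum (hcross 0) (hcross w))
      (mk_union_lt_continuum (mk_union_lt_continuum (hfst 0) (hfst w))
        (mk_union_lt_continuum (mk_union_lt_continuum (hsnd 0) (hsnd w))
          (mk_union_lt_continuum hdir hspan))))
  simp only [mem_union, mem_ofPred_eq, mem_preimage, not_or, sub_zero] at ht
  obtain ⟨⟨c0, cw⟩, ⟨f0, fw⟩, ⟨s0, sw⟩, hd, hsp⟩ := ht
  generalize γ t = p at c0 cw f0 fw s0 sw hd hsp
  have hsp0 : p ∉ Submodule.span ℚ (layer S b) := fun h =>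
    hsp (Submodule.span_mono (subset_insert _ _) h)
  have hp : IsPartialPair (insert (b, p) S) := by
    refine hS.insert_point ?_ ?_ ?_ hsp0
    · exact fun x hx y hy hxy h => c0 ⟨x, hx, y, hy, hxy, h⟩
    · exact fun x hx h => f0 ⟨x, hx, congrArg Prod.fst h⟩
    · exact fun x hx _ => ⟨fun h => f0 ⟨x, hx, h⟩, fun h => s0 ⟨x, hx, h⟩⟩
  refine ⟨p, p - w, sub_sub_cancel p w, hp.insert_point ?_ ?_ ?_ ?_⟩
  · rintro x (rfl | hx) y (rfl | hy) hxy
    · exact absurd rfl hxy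
    · rw [IsPartialPair.cross_swap, neg_ne_zero]
      exact fun h => hd ⟨y, hy, h⟩
    · exact fun h => hd ⟨x, hx, h⟩
    · exact fun h => cw ⟨x, hx, y, hy, hxy, h⟩
  · rintro x (rfl | hx) h
    · exact hw1 (sub_eq_self.1 (congrArg Prod.fst h).symm)
    · exact fw ⟨x, hx, congrArg Prod.fst h⟩
  · rintro x (rfl | hx) -
    · exact ⟨fun h => hw1 (sub_eq_self.1 h.symm), fun h => hw2 (sub_eq_self.1 h.symm)⟩
    · exact ⟨fun h => fw ⟨x, hx, h⟩, fun h => sw ⟨x, hx, h⟩⟩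
  · rw [IsPartialPair.layer_insert_self]
    intro h
    have hwp : w ∈ Submodule.span ℚ (insert p (layer S b)) := by
      have := Submodule.sub_mem _ (Submodule.subset_span (mem_insert p (layer S b))) h
      rwa [sub_sub_cancel] at this
    exact hsp (mem_span_insert_exchange hwp hw)

/-! ### Meeting all requirements -/

/-- Every line in a direction not parallel to an axis can be given two points. -/
lemma IsPartialPair.exists_union_two_onLine {S : Set (Bool × ℝ × ℝ)} (hS : IsPartialPair S)
    (hcard : #S < 𝔠) {p v : ℝ × ℝ} (hv1 : v.1 ≠ 0) (hv2 : v.2 ≠ 0) :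
    ∃ A : Finset (Bool × ℝ × ℝ), IsPartialPair (S ∪ A) ∧
      ∃ x ∈ S ∪ A, ∃ y ∈ S ∪ A, x ≠ y ∧ OnLine p v x.2 ∧ OnLine p v y.2 := by
  classical
  have hv : v ≠ 0 := fun h => hv1 (by simp [h])
  have extend : ∀ S : Set (Bool × ℝ × ℝ), IsPartialPair S → #S < 𝔠 →
      (∃ x ∈ S, ∃ y ∈ S, x ≠ y ∧ OnLine p v x.2 ∧ OnLine p v y.2) ∨
      ∃ q, OnLine p v q ∧ (∀ x ∈ S, x.2 ≠ q) ∧ IsPartialPair (insert (true, q) S) := by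
    intro S hS hcard
    refine or_iff_not_imp_left.2 fun h => ?_
    refine hS.exists_insert_onLine hcard true hv ?_ (absurd · hv1) (absurd · hv2)
    exact fun x hx y hy h1 h2 => by_contra fun hne => h ⟨x, hx, y, hy, hne, h1, h2⟩
  rcases extend S hS hcard with h | ⟨q, hq, -, hSq⟩
  · exact ⟨∅, by simpa using hS, by simpa using h⟩
  have hcard' : #(insert (true, q) S : Set (Bool × ℝ × ℝ)) < 𝔠 :=
    mk_insert_le.trans_lt (add_lt_of_lt aleph0_le_continuum hcard
      (one_lt_aleph0.trans aleph0_lt_continuum))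
  rcases extend _ hSq hcard' with h | ⟨q', hq', hne, hSq'⟩
  · refine ⟨{(true, q)}, ?_⟩
    rw [Finset.coe_singleton, union_singleton]
    exact ⟨hSq, h⟩
  · refine ⟨{(true, q'), (true, q)}, ?_⟩
    rw [Finset.coe_pair, union_insert, union_singleton]
    refine ⟨hSq', (true, q), by simp, (true, q'), by simp, ?_, hq, hq'⟩
    simpa using hne (true, q) (mem_insert _ _)

/-- There is a pair of layers meeting all requirements simultaneously. -/
lemma exists_complete_pair : ∃ S : Set (Bool × ℝ × ℝ), IsPartialPair S ∧
    (∀ p v : ℝ × ℝ, v.1 ≠ 0 → v.2 ≠ 0 →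
      ∃ x ∈ S, ∃ y ∈ S, x ≠ y ∧ OnLine p v x.2 ∧ OnLine p v y.2) ∧
    (∀ b c, ∃ y, (b, c, y) ∈ S) ∧ (∀ b c, ∃ x, (b, x, c) ∈ S) ∧
    ∀ b, ∀ w : ℝ × ℝ, w.1 ≠ 0 → w.2 ≠ 0 → w ∈ Submodule.span ℚ (layer S b) := by
  classical
  let Done : (((ℝ × ℝ) × (ℝ × ℝ)) ⊕ (Bool × ℝ) ⊕ (Bool × ℝ) ⊕ (Bool × ℝ × ℝ)) →
      Set (Bool × ℝ × ℝ) → Prop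
    | .inl (p, v), S => v.1 ≠ 0 → v.2 ≠ 0 →
        ∃ x ∈ S, ∃ y ∈ S, x ≠ y ∧ OnLine p v x.2 ∧ OnLine p v y.2
    | .inr (.inl (b, c)), S => ∃ y, (b, c, y) ∈ S
    | .inr (.inr (.inl (b, c))), S => ∃ x, (b, x, c) ∈ S
    | .inr (.inr (.inr (b, w))), S => w.1 ≠ 0 → w.2 ≠ 0 → w ∈ Submodule.span ℚ (layer S b)
  have done_mono : ∀ t, ∀ S S' : Set (Bool × ℝ × ℝ), S ⊆ S' → Done t S → Done t S' := by
    rintro (⟨p, v⟩ | ⟨b, c⟩ | ⟨b, c⟩ | ⟨b, w⟩) S S' hSS' h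
    · intro h1 h2
      obtain ⟨x, hx, y, hy, h⟩ := h h1 h2
      exact ⟨x, hSS' hx, y, hSS' hy, h⟩
    · exact h.imp fun _ hy => hSS' hy
    · exact h.imp fun _ hx => hSS' hx
    · exact fun h1 h2 => Submodule.span_mono (s := layer S b) (fun _ hp => hSS' hp) (h h1 h2)
  have step : ∀ S : Set (Bool × ℝ × ℝ), IsPartialPair S → #S < 𝔠 → ∀ t,
      ∃ A : Finset (Bool × ℝ × ℝ), IsPartialPair (S ∪ A) ∧ Done t (S ∪ A) := by
    rintro S hS hcard t
    by_cases hdone : Done t S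
    · exact ⟨∅, by simpa using hS, by simpa using hdone⟩
    rcases t with ⟨p, v⟩ | ⟨b, c⟩ | ⟨b, c⟩ | ⟨b, w⟩
    · by_cases hv : v.1 ≠ 0 ∧ v.2 ≠ 0
      · obtain ⟨A, hA, h⟩ := hS.exists_union_two_onLine hcard (p := p) hv.1 hv.2
        exact ⟨A, hA, fun _ _ => h⟩
      · exact absurd (fun h1 h2 => absurd ⟨h1, h2⟩ hv) hdone
    · have hfree : ∀ x ∈ S, x.1 = b → x.2.1 ≠ c := by
        rintro ⟨b', x, y⟩ hx rfl rfl
        exact hdone ⟨y, hx⟩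
      have hL : ∀ x ∈ S, ∀ y ∈ S, OnLine (c, 0) (0, 1) x.2 → OnLine (c, 0) (0, 1) y.2 → x = y := by
        intro x hx y hy h1 h2
        simp only [OnLine] at h1 h2
        by_contra hne
        refine (hS.coord_ne x hx y hy ?_ hne).1 (by linarith)
        have hxb : x.1 ≠ b := fun h => hfree x hx h (by linarith)
        have hyb : y.1 ≠ b := fun h => hfree y hy h (by linarith)
        rw [Bool.eq_not_of_ne hxb, Bool.eq_not_of_ne hyb]
      obtain ⟨q, hq, -, h⟩ := hS.exists_insert_onLine hcard b (p := (c, 0)) (v := (0, 1))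
        (by simp) hL (fun _ => hfree) (by simp)
      refine ⟨{(b, q)}, ?_⟩
      rw [Finset.coe_singleton, union_singleton]
      have hqc : q.1 = c := by simp only [OnLine] at hq; linarith
      exact ⟨h, q.2, by simp [← hqc]⟩
    · have hfree : ∀ x ∈ S, x.1 = b → x.2.2 ≠ c := by
        rintro ⟨b', x, y⟩ hx rfl rfl
        exact hdone ⟨x, hx⟩
      have hL : ∀ x ∈ S, ∀ y ∈ S, OnLine (0, c) (1, 0) x.2 → OnLine (0, c) (1, 0) y.2 → x = y := by
        intro x hx y hy h1 h2
        simp only [OnLine] at h1 h2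
        by_contra hne
        refine (hS.coord_ne x hx y hy ?_ hne).2 (by linarith)
        have hxb : x.1 ≠ b := fun h => hfree x hx h (by linarith)
        have hyb : y.1 ≠ b := fun h => hfree y hy h (by linarith)
        rw [Bool.eq_not_of_ne hxb, Bool.eq_not_of_ne hyb]
      obtain ⟨q, hq, -, h⟩ := hS.exists_insert_onLine hcard b (p := (0, c)) (v := (1, 0))
        (by simp) hL (by simp) (fun _ => hfree)
      refine ⟨{(b, q)}, ?_⟩
      rw [Finset.coe_singleton, union_singleton]
      have hqc : q.2 = c := by simp only [OnLine] at hq; linarith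
      exact ⟨h, q.1, by simp [← hqc]⟩
    · by_cases hw : w.1 ≠ 0 ∧ w.2 ≠ 0
      · have hspan : w ∉ Submodule.span ℚ (layer S b) := fun h => hdone fun _ _ => h
        obtain ⟨p, q, rfl, h⟩ := hS.exists_insert_sub_eq hcard b hw.1 hw.2 hspan
        refine ⟨{(b, q), (b, p)}, ?_⟩
        rw [Finset.coe_pair, union_insert, union_singleton]
        refine ⟨h, fun _ _ => Submodule.sub_mem _ (Submodule.subset_span ?_)
          (Submodule.subset_span ?_)⟩ <;> simp [layer]
      · exact absurd (fun h1 h2 => absurd ⟨h1, h2⟩ hw) hdone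
  obtain ⟨S, hS, hDone⟩ := exists_forall_of_finite_extension
    (T := ((ℝ × ℝ) × (ℝ × ℝ)) ⊕ (Bool × ℝ) ⊕ (Bool × ℝ) ⊕ (Bool × ℝ × ℝ))
    (by simp [mk_real]) IsPartialPair Done (fun _ _ => IsPartialPair.mono)
    (fun _ => IsPartialPair.of_finset) done_mono IsPartialPair.empty step
  exact ⟨S, hS, fun p v => hDone (.inl (p, v)), fun b c => hDone (.inr (.inl (b, c))),
    fun b c => hDone (.inr (.inr (.inl (b, c)))), fun b w => hDone (.inr (.inr (.inr (b, w))))⟩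

lemma span_eq_top_of_forall_coord_ne_zero {W : Submodule ℚ (ℝ × ℝ)}
    (h : ∀ w : ℝ × ℝ, w.1 ≠ 0 → w.2 ≠ 0 → w ∈ W) : W = ⊤ := by
  refine (Submodule.eq_top_iff').2 fun w => ?_
  obtain ⟨a, ha⟩ := Set.Infinite.nonempty
    ((Set.toFinite ({0, w.1} : Set ℝ)).infinite_compl)
  obtain ⟨c, hc⟩ := Set.Infinite.nonempty
    ((Set.toFinite ({0, w.2} : Set ℝ)).infinite_compl)
  simp only [mem_compl_iff, mem_insert_iff, mem_singleton_iff, not_or] at ha hc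
  have hsum : w = (a, c) + (w.1 - a, w.2 - c) := by ext <;> simp
  rw [hsum]
  exact W.add_mem (h _ ha.1 hc.1)
    (h _ (sub_ne_zero.2 (Ne.symm ha.2)) (sub_ne_zero.2 (Ne.symm hc.2)))

lemma mem_lineThrough_iff_onLine {p v : ℝ × ℝ} (hv : v ≠ 0) (q : ℝ × ℝ) :
    q ∈ lineThrough p v ↔ OnLine p v q := by
  constructor
  · rintro ⟨t, rfl⟩
    simp only [OnLine, Prod.fst_add, Prod.snd_add, Prod.smul_fst, Prod.smul_snd, smul_eq_mul]
    ring
  · intro h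
    simp only [OnLine] at h
    by_cases h1 : v.1 = 0
    · have h2 : v.2 ≠ 0 := fun h2 => hv (Prod.ext h1 h2)
      refine ⟨(q.2 - p.2) / v.2, Prod.ext ?_ ?_⟩
      · have : v.2 * (q.1 - p.1) = 0 := by rw [h1] at h; linarith
        have := (mul_eq_zero.1 this).resolve_left h2
        simp [h1]; linarith
      · simp [h2]
    · refine ⟨(q.1 - p.1) / v.1, Prod.ext ?_ ?_⟩
      · simp [h1]
      · simp only [Prod.snd_add, Prod.smul_snd, smul_eq_mul]
        field_simp
        linarith

lemma IsPartialPair.encard_lineThrough_eq_two {S : Set (Bool × ℝ × ℝ)} (hS : IsPartialPair S)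
    {p v : ℝ × ℝ} (hv : v ≠ 0)
    (h : ∃ x ∈ S, ∃ y ∈ S, x ≠ y ∧ OnLine p v x.2 ∧ OnLine p v y.2) :
    ((layer S true ∪ layer S false) ∩ lineThrough p v).encard = 2 := by
  obtain ⟨x, hx, y, hy, hxy, hxL, hyL⟩ := h
  have hunion : layer S true ∪ layer S false = {q | ∃ b, (b, q) ∈ S} := by
    ext q; simp [layer, or_comm]
  rw [hunion, encard_eq_two]
  refine ⟨x.2, y.2, hS.point_ne x hx y hy hxy, ?_⟩
  ext q
  simp only [mem_inter_iff, mem_ofPred_eq, mem_insert_iff, mem_singleton_iff,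
    mem_lineThrough_iff_onLine hv]
  constructor
  · rintro ⟨⟨b, hb⟩, hq⟩
    by_contra! hne
    refine hS.cross_ne x hx y hy (b, q) hb hxy ?_ ?_ ?_
    · rintro rfl; exact hne.1 rfl
    · rintro rfl; exact hne.2 rfl
    · simp only [OnLine] at hxL hyL hq
      simp only [cross]
      by_cases h1 : v.1 = 0
      · have h2 : v.2 ≠ 0 := fun h2 => hv (Prod.ext h1 h2)
        refine (mul_eq_zero.1 ?_).resolve_left h2
        linear_combination (q.2 - y.2.2) * hxL + (x.2.2 - q.2) * hyL + (y.2.2 - x.2.2) * hq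
      · refine (mul_eq_zero.1 ?_).resolve_left h1
        linear_combination (q.1 - y.2.1) * hxL + (x.2.1 - q.1) * hyL + (y.2.1 - x.2.1) * hq
  · rintro (rfl | rfl)
    · exact ⟨⟨x.1, hx⟩, hxL⟩
    · exact ⟨⟨y.1, hy⟩, hyL⟩

/-- There is a pair of bijective Hamel functions with disjoint graphs whose union is
a Mazurkiewicz set. -/
theorem stmt_18 :
    ∃ f g : ℝ → ℝ, Function.Bijective f ∧ Function.Bijective g ∧
      IsHamelFun f ∧ IsHamelFun g ∧ (∀ x : ℝ, f x ≠ g x) ∧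
      IsMazurkiewicz (graphOf f ∪ graphOf g) := by
  obtain ⟨S, hS, hline, hvert, hhor, hspan⟩ := exists_complete_pair
  choose F hF using hvert
  have hunique : ∀ b x y, (b, x, y) ∈ S → y = F b x := by
    intro b x y h
    by_contra hne
    exact (hS.coord_ne _ h _ (hF b x) rfl (by simpa using hne)).1 rfl
  have hlayer : ∀ b, layer S b = graphOf (F b) := by
    intro b
    ext ⟨x, y⟩
    constructor
    · exact fun h => ⟨x, by rw [← hunique b x y h]⟩
    · rintro ⟨x', h⟩
      rw [h]
      exact hF b x'
  have hbij : ∀ b, Function.Bijective (F b) := by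
    refine fun b => ⟨fun x y hxy => ?_, fun c => ?_⟩
    · by_contra hne
      exact (hS.coord_ne _ (hF b x) _ (hF b y) rfl (by simp [hne])).2 hxy
    · obtain ⟨x, hx⟩ := hhor b c
      exact ⟨x, (hunique b x c hx).symm⟩
  have hHamel : ∀ b, IsHamelFun (F b) := by
    intro b
    rw [IsHamelFun, ← hlayer]
    exact ⟨hS.indep b, span_eq_top_of_forall_coord_ne_zero (hspan b)⟩
  refine ⟨F true, F false, hbij _, hbij _, hHamel _, hHamel _, fun x hx => ?_, ?_⟩
  · exact hS.point_ne _ (hF true x) _ (hF false x) (by simp) (by simp [hx])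
  · rintro L ⟨p, v, hv, rfl⟩
    rw [← hlayer, ← hlayer]
    refine hS.encard_lineThrough_eq_two hv ?_
    by_cases h1 : v.1 = 0
    · exact ⟨_, hF true p.1, _, hF false p.1, by simp, by simp [OnLine, h1], by simp [OnLine, h1]⟩
    by_cases h2 : v.2 = 0
    · obtain ⟨x, hx⟩ := hhor true p.2
      obtain ⟨y, hy⟩ := hhor false p.2
      exact ⟨_, hx, _, hy, by simp, by simp [OnLine, h2], by simp [OnLine, h2]⟩
    exact hline p v h1 h2
end
end
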